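/- Let q ∈ ℕ, q ≥ 2. Then δ({1, 2, …, q−1}) = 1/q. -/

import Mathlib

open Real

/-- Evaluation of the trigonometric polynomial with (finitely supported) cosine
coefficients `c` at the point `x`:  `T(x) = Σ_k c k · cos(2πkx)`.
The constant term is the `k = 0` coefficient. -/
noncomputable def trigEval (c : ℕ →₀ ℝ) (x : ℝ) : ℝ :=
  c.sum fun k a => a * Real.cos (2 * π * k * x)

/-- The class `𝐓(K)`: trigonometric polynomials `T(x) = T₀ + Σ_{k ∈ K} T_k cos(2πkx)`
(nonzero-frequency coefficients supported in `K`), with `T(x) ≥ 0` for all `x`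
and `T(0) = 1`.  A polynomial is represented by its coefficient function. -/
def TrigClass (K : Set ℕ) : Set (ℕ →₀ ℝ) :=
  {c | (∀ k : ℕ, k ≠ 0 → c k ≠ 0 → k ∈ K) ∧
       (∀ x : ℝ, 0 ≤ trigEval c x) ∧
       trigEval c 0 = 1}

/-- `δ(K) = inf_{T ∈ 𝐓(K)} T₀`. -/
noncomputable def delta (K : Set ℕ) : ℝ :=
  sInf ((fun c : ℕ →₀ ℝ => c 0) '' TrigClass K)

/-- The Turán class `K(h)`, described by the cosine coefficient sequence `a`:
`a_n ≥ 0`, `Σ a_n = 1` (i.e. `f(0) = 1`), and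
`f(x) = Σ_n a_n cos(2πnx) = 0` for `h ≤ |x| ≤ 1/2`. -/
def TuranClass (h : ℝ) : Set (ℕ → ℝ) :=
  {a | (∀ n, 0 ≤ a n) ∧ Summable a ∧ (∑' n, a n) = 1 ∧
       ∀ x : ℝ, h ≤ |x| → |x| ≤ 1 / 2 →
         (∑' n : ℕ, a n * Real.cos (2 * π * n * x)) = 0}

/-- `A(h) = sup_{f ∈ K(h)} a₀`. -/
noncomputable def turanA (h : ℝ) : ℝ :=
  sSup ((fun a : ℕ → ℝ => a 0) '' TuranClass h)

/-- `K⁰_{p,q} = {p, p+1, …, q−p}`. -/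
def Kset0 (p q : ℕ) : Set ℕ := {k | p ≤ k ∧ k ≤ q - p}

/-- `K_{p,q} = {qν + k : ν ∈ ℤ₊, k ∈ K⁰_{p,q}}`. -/
def Kset (p q : ℕ) : Set ℕ :=
  {k | ∃ ν k' : ℕ, k = q * ν + k' ∧ p ≤ k' ∧ k' ≤ q - p}

theorem aux_geom (q k : ℕ) (hk : 0 < k) (hkq : k < q) :
    ∑ j ∈ Finset.range q, Real.cos (2 * π * k * ((j : ℝ) / q)) = 0 := by
  have hq : q ≠ 0 := by omega
  have hp := Complex.isPrimitiveRoot_exp q hq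
  set z : ℂ := Complex.exp (2 * π * Complex.I / q) with hz
  have h1 : z ^ k ≠ 1 := hp.pow_ne_one_of_pos_of_lt hk.ne' hkq
  have h2 : (z ^ k) ^ q = 1 := by
    rw [← pow_mul, mul_comm, pow_mul, hp.pow_eq_one, one_pow]
  have h3 : ∑ j ∈ Finset.range q, (z ^ k) ^ j = 0 := by
    have := geom_sum_mul (z ^ k) q
    rw [h2, sub_self] at this
    rcases mul_eq_zero.mp this with h | h
    · exact h
    · exact absurd (sub_eq_zero.mp h) h1
  have h4 := congrArg Complex.re h3
  rw [Complex.re_sum] at h4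
  rw [Complex.zero_re] at h4
  rw [← h4]
  refine Finset.sum_congr rfl fun j _ => ?_
  rw [← pow_mul, hz, ← Complex.exp_nat_mul, ← Complex.exp_ofReal_mul_I_re]
  congr 2
  push_cast
  ring

theorem aux_fejer (t : ℝ) (n : ℕ) :
    ∑ k ∈ Finset.range n, ((n : ℝ) - k) * (2 * Real.cos (k * t)) - n
      = (∑ k ∈ Finset.range n, Real.cos (k * t)) ^ 2
        + (∑ k ∈ Finset.range n, Real.sin (k * t)) ^ 2 := by
  induction n with
  | zero => simp
  | succ n ih =>
    have e1 : ∑ k ∈ Finset.range (n + 1), (((n + 1 : ℕ) : ℝ) - k) * (2 * Real.cos (k * t))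
        = ∑ k ∈ Finset.range n, ((n : ℝ) - k) * (2 * Real.cos (k * t))
          + 2 * ∑ k ∈ Finset.range (n + 1), Real.cos (k * t) := by
      rw [Finset.mul_sum, Finset.sum_range_succ, Finset.sum_range_succ _ n, ← add_assoc,
        ← Finset.sum_add_distrib]
      congr 1
      · refine Finset.sum_congr rfl fun k _ => ?_
        push_cast
        ring
      · push_cast
        ring
    have e2 : ∑ k ∈ Finset.range (n + 1), Real.cos (k * t)
        = Real.cos (n * t) * ∑ k ∈ Finset.range n, Real.cos (k * t)
          + Real.sin (n * t) * ∑ k ∈ Finset.range n, Real.sin (k * t) + 1 := by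
      rw [← Finset.sum_range_reflect, Finset.sum_range_succ, Finset.mul_sum, Finset.mul_sum,
        ← Finset.sum_add_distrib]
      congr 1
      · refine Finset.sum_congr rfl fun k hk => ?_
        have hk := Finset.mem_range.mp hk
        rw [← Real.cos_sub, ← sub_mul, show n + 1 - 1 - k = n - k by omega,
          Nat.cast_sub hk.le]
      · simp
    rw [e2] at e1
    rw [e1, Finset.sum_range_succ, Finset.sum_range_succ]
    have := Real.sin_sq_add_cos_sq (n * t)
    push_cast
    linear_combination ih - this

theorem aux_eval (q : ℕ) (c : ℕ →₀ ℝ) (h : ∀ k, c k ≠ 0 → k < q) (x : ℝ) :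
    trigEval c x = ∑ k ∈ Finset.range q, c k * Real.cos (2 * π * k * x) := by
  unfold trigEval
  apply Finsupp.sum_of_support_subset
  · intro k hk
    exact Finset.mem_range.mpr (h k (Finsupp.mem_support_iff.mp hk))
  · simp

/-- The Fejer coefficients. -/
noncomputable def fejerC (q : ℕ) : ℕ →₀ ℝ :=
  Finsupp.onFinset (Finset.range q)
    (fun k => if k < q then (((q : ℝ) - k) * 2 - if k = 0 then (q : ℝ) else 0) / q ^ 2 else 0)
    (by
      intro k hk
      by_contra h
      exact hk (if_neg (by simpa using h)))

theorem fejerC_apply (q k : ℕ) : fejerC q k =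
    if k < q then (((q : ℝ) - k) * 2 - if k = 0 then (q : ℝ) else 0) / q ^ 2 else 0 := rfl

theorem fejerC_lt (q k : ℕ) (h : fejerC q k ≠ 0) : k < q := by
  by_contra h'
  exact h (by rw [fejerC_apply, if_neg h'])

theorem fejerC_eval (q : ℕ) (hq : 0 < q) (x : ℝ) : trigEval (fejerC q) x =
    ((∑ k ∈ Finset.range q, Real.cos (k * (2 * π * x))) ^ 2
        + (∑ k ∈ Finset.range q, Real.sin (k * (2 * π * x))) ^ 2) / q ^ 2 := by
  rw [aux_eval q _ (fejerC_lt q), ← aux_fejer]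
  have : (q : ℝ) = ∑ k ∈ Finset.range q, if k = 0 then (q : ℝ) else 0 := by
    rw [Finset.sum_ite_eq']
    simp [hq]
  conv_rhs => enter [1, 2]; rw [this]
  rw [← Finset.sum_sub_distrib, Finset.sum_div]
  refine Finset.sum_congr rfl fun k hk => ?_
  rw [fejerC_apply, if_pos (Finset.mem_range.mp hk),
    show 2 * π * k * x = k * (2 * π * x) by ring]
  split_ifs with h0
  · subst h0
    simp
  · ring

/-- Example 1 (finite part):  `δ({1, 2, …, q−1}) = 1/q` for `q ≥ 2`. -/
theorem stmt_12 (q : ℕ) (hq : 2 ≤ q) :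
    delta {k : ℕ | 1 ≤ k ∧ k ≤ q - 1} = 1 / q := by
  have hq0 : (0 : ℝ) < q := by exact_mod_cast (by omega : 0 < q)
  unfold delta
  apply IsLeast.csInf_eq
  constructor
  · refine ⟨fejerC q, ⟨?_, ?_, ?_⟩, ?_⟩
    · intro k hk h
      have := fejerC_lt q k h
      exact ⟨by omega, by omega⟩
    · intro x
      rw [fejerC_eval q (by omega)]
      positivity
    · rw [fejerC_eval q (by omega)]
      simp [hq0.ne']
    · show fejerC q 0 = _
      rw [fejerC_apply, if_pos (by omega), if_pos rfl]
      push_cast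
      field_simp
      ring
  · rintro _ ⟨c, ⟨h1, h2, h3⟩, rfl⟩
    show 1 / (q : ℝ) ≤ c 0
    have hs : ∀ k, c k ≠ 0 → k < q := by
      intro k hk
      rcases Nat.eq_zero_or_pos k with h | h
      · omega
      · have := (h1 k h.ne' hk).2
        omega
    have hsum : ∑ j ∈ Finset.range q, trigEval c ((j : ℝ) / q) = q * c 0 := by
      simp_rw [aux_eval q c hs]
      rw [Finset.sum_comm, Finset.sum_eq_single 0]
      · simp
      · intro k hk hk0
        rw [← Finset.mul_sum, aux_geom q k (Nat.pos_of_ne_zero hk0) (Finset.mem_range.mp hk),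
          mul_zero]
      · intro h
        exact absurd (Finset.mem_range.mpr (by omega)) h
    have hle := Finset.single_le_sum (f := fun j : ℕ => trigEval c ((j : ℝ) / q))
      (fun j _ => h2 _) (Finset.mem_range.mpr (by omega : 0 < q))
    rw [hsum] at hle
    simp only [Nat.cast_zero, zero_div, h3] at hle
    rw [div_le_iff₀ hq0]
    linarith
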